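/- Let Y be a finite nonempty set, let θ : Y → ℝ, let c be the Euler–Mascheroni constant, and set Ẑ = ∑_{y∈Y} e^{θ(y)}. Then for every ŷ ∈ Y, ∫_ℝ exp(−(t − θ(ŷ) + c)) · exp( − ∑_{y∈Y} exp(−(t − θ(y) + c)) ) dt = e^{θ(ŷ)} / Ẑ. Equivalently, with the zero-mean Gumbel density g(t) = exp(−(t+c) − exp(−(t+c))) and cumulative distribution function G(t) = exp(−exp(−(t+c))), ∫_ℝ g(t − θ(ŷ)) · ∏_{y∈Y, y≠ŷ} G(t − θ(y)) dt = e^{θ(ŷ)} / Ẑ. -/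

import Mathlib

open MeasureTheory

theorem integral_exp_neg_mul_exp_neg_mul_exp_neg {A : ℝ} (hA : 0 < A) :
    ∫ t : ℝ, Real.exp (-t) * Real.exp (-(A * Real.exp (-t))) = A⁻¹ := by
  have himage : (fun t : ℝ => Real.exp (-t)) '' Set.univ = Set.Ioi 0 := by
    rw [Set.image_univ, ← Real.range_exp]
    exact neg_surjective.range_comp Real.exp
  have hderiv (t : ℝ) : HasDerivAt (fun t : ℝ => Real.exp (-t)) (-Real.exp (-t)) t := by
    simpa using (hasDerivAt_neg t).exp
  have hsubst := integral_image_eq_integral_abs_deriv_smul MeasurableSet.univ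
    (fun t _ => (hderiv t).hasDerivWithinAt)
    (Real.exp_injective.comp neg_injective).injOn (fun x : ℝ => Real.exp (-A * x))
  rw [himage, integral_exp_mul_Ioi (neg_lt_zero.mpr hA) 0] at hsubst
  simpa using hsubst.symm

theorem integral_gumbel_density_mul_exp_neg_sum {Y : Type*} [Fintype Y] [Nonempty Y]
    (θ : Y → ℝ) (c a : ℝ) :
    ∫ t : ℝ, Real.exp (-(t - a + c)) * Real.exp (-∑ y, Real.exp (-(t - θ y + c))) =
      Real.exp a / ∑ y, Real.exp (θ y) := by
  have hsum : 0 < ∑ y, Real.exp (θ y) :=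
    Finset.sum_pos (fun y _ => Real.exp_pos _) Finset.univ_nonempty
  have hsplit (t b : ℝ) :
      Real.exp (-(t - b + c)) = Real.exp (-c) * Real.exp b * Real.exp (-t) := by
    rw [← Real.exp_add, ← Real.exp_add]
    ring_nf
  simp_rw [hsplit, ← Finset.sum_mul, ← Finset.mul_sum, mul_assoc (Real.exp (-c) * Real.exp a)]
  rw [integral_const_mul,
    integral_exp_neg_mul_exp_neg_mul_exp_neg (mul_pos (Real.exp_pos (-c)) hsum)]
  field_simp

/-- the Gumbel-max integral identity.
Let `Y` be finite nonempty, `θ : Y → ℝ`, `c` the Euler–Mascheroni constant and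
`Ẑ = ∑_y exp (θ y)`.  Then for every `yh ∈ Y`,
`∫ exp(−(t − θ yh + c)) · exp(−∑_y exp(−(t − θ y + c))) dt = exp (θ yh) / Ẑ`;
equivalently, with the zero-mean Gumbel density
`g(t) = exp(−(t + c) − exp(−(t + c)))` and CDF `G(t) = exp(−exp(−(t + c)))`,
`∫ g(t − θ yh) · ∏_{y ≠ yh} G(t − θ y) dt = exp (θ yh) / Ẑ`. -/
theorem gumbel_max_integral_identity
    {Y : Type*} [Fintype Y] [Nonempty Y] [DecidableEq Y] (θ : Y → ℝ) (yh : Y) :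
    (∫ t : ℝ, Real.exp (-(t - θ yh + Real.eulerMascheroniConstant)) *
        Real.exp (-∑ y, Real.exp (-(t - θ y + Real.eulerMascheroniConstant)))
      = Real.exp (θ yh) / ∑ y, Real.exp (θ y)) ∧
    (∫ t : ℝ, Real.exp (-(t - θ yh + Real.eulerMascheroniConstant)
          - Real.exp (-(t - θ yh + Real.eulerMascheroniConstant))) *
        ∏ y ∈ Finset.univ.erase yh,
          Real.exp (-Real.exp (-(t - θ y + Real.eulerMascheroniConstant)))
      = Real.exp (θ yh) / ∑ y, Real.exp (θ y)) := by
  have hintegral := integral_gumbel_density_mul_exp_neg_sum θ Real.eulerMascheroniConstant (θ yh)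
  refine ⟨hintegral, ?_⟩
  rw [← hintegral]
  refine integral_congr_ae (.of_forall fun t => ?_)
  dsimp only
  rw [← Finset.add_sum_erase _ _ (Finset.mem_univ yh), ← Real.exp_sum, Finset.sum_neg_distrib,
    ← Real.exp_add, ← Real.exp_add]
  ring_nf
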